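/- Suppose r ∈ (-1,1], ν is a probability distribution on ℤ with ν(-2) > 0, and h_r^{(0)} is ν-harmonic on ℤ_{>0}. Then the random walk (X_i) does not drift to +∞: P(X_i ≥ X_0 for all i ≥ 0) = 0. -/

import Mathlib

open scoped BigOperators

noncomputable def h0 (r : ℝ) (l : ℤ) : ℝ :=
  if 0 ≤ l then
    (4 : ℝ) ^ (-l) *
      ∑ m ∈ Finset.range (l.toNat + 1),
        (Nat.choose (2 * m) m : ℝ) * (Nat.choose (2 * (l.toNat - m)) (l.toNat - m) : ℝ) *
          (-r) ^ (l.toNat - m)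
  else 0

noncomputable def h1 (r : ℝ) (l : ℤ) : ℝ :=
  if 1 ≤ l then ∑ p ∈ Finset.range l.toNat, h0 r (p : ℤ) else 0

noncomputable def h2 (r : ℝ) (l : ℤ) : ℝ :=
  if 2 ≤ l then ∑ p ∈ Finset.Icc 1 (l.toNat - 1), h1 r (p : ℤ) else 0

noncomputable def hm1 (r : ℝ) (l : ℤ) : ℝ := h0 r (l + 1) - h0 r l

noncomputable def hm2 (r : ℝ) (l : ℤ) : ℝ := hm1 r (l + 1) - hm1 r l

noncomputable def kernelR (r : ℝ) (k m : ℤ) : ℝ :=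
  ∑ p ∈ Finset.range m.toNat,
    h1 r (m - (p : ℤ)) * (hm2 r (k + (p : ℤ) - 1) + r * hm2 r (k + (p : ℤ) - 2))

/-- `ν` is a probability distribution on `ℤ`. -/
def IsProbDist (ν : ℤ → ℝ) : Prop := (∀ k, 0 ≤ ν k) ∧ HasSum ν 1

/-- A nonnegative function `f : ℤ → [0,∞)` is `ν`-harmonic on `ℤ_{>0}`. -/
def NuHarmonic (ν : ℤ → ℝ) (f : ℤ → ℝ) : Prop :=
  (∀ l, 0 ≤ f l) ∧ ∀ k : ℤ, 1 ≤ k → HasSum (fun l : ℤ => f (k + l) * ν l) (f k)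

noncomputable def Lnu (r : ℝ) (ν : ℤ → ℝ) : ℝ :=
  ∑' k : ℕ, ν ((k : ℤ) + 1) * h2 r ((k : ℤ) + 2)

noncomputable def phiNu (ν : ℤ → ℝ) (θ : ℝ) : ℂ :=
  ∑' k : ℤ, (ν k : ℂ) * Complex.exp (Complex.I * (k : ℂ) * (θ : ℂ))

open MeasureTheory ProbabilityTheory

section Analytic

open Filter Topology PowerSeries

/-- The power series of `(1 - X) ^ (-1 / 2)`. -/
noncomputable def invSqrtSeries : PowerSeries ℝ :=
  PowerSeries.mk fun n => (n.centralBinom : ℝ) / 4 ^ n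

/-- The power series of `(1 - X) ^ (-1 / 2) * (1 + r X) ^ (-1 / 2)`. -/
noncomputable def h0Series (r : ℝ) : PowerSeries ℝ :=
  invSqrtSeries * rescale (-r) invSqrtSeries

lemma coeff_invSqrtSeries_succ (n : ℕ) :
    coeff (n + 1) invSqrtSeries * (2 * (n + 1)) = coeff n invSqrtSeries * (2 * n + 1) := by
  have h : ((n : ℝ) + 1) * (n + 1).centralBinom = 2 * (2 * n + 1) * n.centralBinom := by
    exact_mod_cast Nat.succ_mul_centralBinom_succ n
  simp only [invSqrtSeries, coeff_mk, pow_succ]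
  field_simp
  linarith

lemma invSqrtSeries_sq_mul : invSqrtSeries ^ 2 * (1 - X) = 1 := by
  have key : 2 * ((1 - X) * derivative ℝ invSqrtSeries) = invSqrtSeries := by
    ext n
    have e : (2 : PowerSeries ℝ) = C 2 := (map_ofNat C 2).symm
    rw [e, coeff_C_mul, sub_mul, one_mul, map_sub]
    cases n with
    | zero =>
      have := coeff_invSqrtSeries_succ 0
      simp only [coeff_zero_X_mul, coeff_derivative]
      push_cast at this ⊢
      linarith
    | succ n =>
      have := coeff_invSqrtSeries_succ (n + 1)
      simp only [coeff_succ_X_mul, coeff_derivative]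
      push_cast at this ⊢
      linarith
  apply derivative.ext
  · simp only [Derivation.leibniz, Derivation.leibniz_pow, map_sub, derivative_X, smul_eq_mul,
      nsmul_eq_mul, Derivation.map_one_eq_zero]
    push_cast
    linear_combination invSqrtSeries * key
  · simp [invSqrtSeries, constantCoeff_mk]

lemma h0Series_sq_mul (r : ℝ) : h0Series r ^ 2 * ((1 - X) * (1 + C r * X)) = 1 := by
  have h1 := invSqrtSeries_sq_mul
  have h2 := congrArg (rescale (-r)) h1
  simp only [map_mul, map_pow, map_sub, map_one, rescale_X] at h2
  rw [map_neg] at h2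
  rw [h0Series]
  linear_combination (rescale (-r) invSqrtSeries) ^ 2 * (1 + C r * X) * h1 + h2

lemma h0_natCast (r : ℝ) (n : ℕ) : h0 r n = coeff n (h0Series r) := by
  rw [h0, if_pos (by positivity), h0Series, coeff_mul,
    Finset.Nat.sum_antidiagonal_eq_sum_range_succ_mk, Finset.mul_sum, Int.toNat_natCast]
  refine Finset.sum_congr rfl fun m hm => ?_
  have hmn : m ≤ n := by simpa [Nat.lt_succ_iff] using hm
  have e : (4 : ℝ) ^ n = 4 ^ m * 4 ^ (n - m) := by rw [← pow_add]; congr 1; omega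
  rw [coeff_rescale]
  simp only [invSqrtSeries, coeff_mk, Nat.centralBinom]
  rw [zpow_neg, zpow_natCast, e]
  field_simp

lemma h0_of_neg (r : ℝ) {l : ℤ} (hl : l < 0) : h0 r l = 0 := by
  rw [h0, if_neg (by omega)]

lemma h0_zero (r : ℝ) : h0 r 0 = 1 := by
  simp [h0]

lemma tendsto_zero_of_sq_mul_le_one {a : ℕ → ℝ} (h : ∀ n, a n ^ 2 * (n + 1) ≤ 1) :
    Tendsto a atTop (𝓝 0) := by
  have h2 : Tendsto (fun n => a n ^ 2) atTop (𝓝 0) := by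
    refine squeeze_zero (fun n => sq_nonneg _) (fun n => ?_)
      (tendsto_one_div_add_atTop_nhds_zero_nat (𝕜 := ℝ))
    rw [le_div_iff₀ (by positivity)]
    exact h n
  exact tendsto_zero_iff_abs_tendsto_zero _ |>.2 (by
    simpa [Function.comp_def, Real.sqrt_sq_eq_abs] using h2.sqrt)

lemma tendsto_coeff_invSqrtSeries :
    Tendsto (fun n => coeff n invSqrtSeries) atTop (𝓝 0) := by
  apply tendsto_zero_of_sq_mul_le_one
  intro n
  have : coeff n invSqrtSeries ^ 2 * (2 * n + 1) ≤ 1 := by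
    induction n with
    | zero => simp [invSqrtSeries]
    | succ n ih =>
      have e : coeff (n + 1) invSqrtSeries
          = coeff n invSqrtSeries * (2 * n + 1) / (2 * (n + 1)) := by
        rw [eq_div_iff (by positivity), coeff_invSqrtSeries_succ]
      have hn : (0 : ℝ) ≤ n := by positivity
      rw [e, div_pow, mul_pow, div_mul_eq_mul_div, div_le_one (by positivity)]
      push_cast
      nlinarith [mul_le_mul_of_nonneg_right ih
        (show (0 : ℝ) ≤ (2 * n + 1) * (2 * n + 3) by positivity)]
  nlinarith [mul_nonneg (sq_nonneg (coeff n invSqrtSeries)) (Nat.cast_nonneg (α := ℝ) n)]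

lemma coeff_h0Series_one_add_two (n : ℕ) :
    coeff (n + 2) (h0Series 1) * (n + 2) = coeff n (h0Series 1) * (n + 1) := by
  have h := h0Series_sq_mul 1
  have hne : h0Series 1 ≠ 0 := by
    rintro h0
    simp [h0] at h
  have hd := congrArg (derivative ℝ) h
  simp only [map_one, one_mul, Derivation.leibniz, Derivation.leibniz_pow, map_sub, map_add,
    derivative_X, smul_eq_mul, nsmul_eq_mul, Derivation.map_one_eq_zero] at hd
  push_cast at hd
  have key : derivative ℝ (h0Series 1) = X * (X * derivative ℝ (h0Series 1)) + X * h0Series 1 := by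
    have h2 : (2 : PowerSeries ℝ) ≠ 0 := by
      rw [← map_ofNat C 2]
      simp
    apply mul_left_cancel₀ (mul_ne_zero h2 hne)
    linear_combination hd
  have := congrArg (coeff (n + 1)) key
  cases n with
  | zero =>
    simp only [map_add, coeff_succ_X_mul, coeff_derivative, coeff_zero_X_mul] at this
    push_cast at this ⊢
    linarith
  | succ n =>
    simp only [map_add, coeff_succ_X_mul, coeff_derivative] at this
    push_cast at this ⊢
    linarith

lemma coeff_zero_h0Series (r : ℝ) : coeff 0 (h0Series r) = 1 := by
  have := h0_natCast r 0
  rwa [Nat.cast_zero, h0_zero, eq_comm] at this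

lemma coeff_one_h0Series_one : coeff 1 (h0Series 1) = 0 := by
  have := h0_natCast 1 1
  rw [← this]
  norm_num [h0, Finset.sum_range_succ]

lemma tendsto_coeff_h0Series_one :
    Tendsto (fun n => coeff n (h0Series 1)) atTop (𝓝 0) := by
  apply tendsto_zero_of_sq_mul_le_one
  intro n
  induction n using Nat.twoStepInduction with
  | zero => simp [coeff_zero_h0Series]
  | one => simp [coeff_one_h0Series_one]
  | more n ih _ =>
    have e : coeff (n + 2) (h0Series 1) = coeff n (h0Series 1) * (n + 1) / (n + 2) := by
      rw [eq_div_iff (by positivity), coeff_h0Series_one_add_two]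
    have hn : (0 : ℝ) ≤ n := by positivity
    rw [e, div_pow, mul_pow, div_mul_eq_mul_div, div_le_one (by positivity)]
    push_cast
    nlinarith [mul_le_mul_of_nonneg_right ih
      (show (0 : ℝ) ≤ (n + 1) * (n + 3) by positivity)]

lemma tendsto_coeff_mul_of_summable {f g : PowerSeries ℝ}
    (hf : Tendsto (fun n => coeff n f) atTop (𝓝 0)) (hg : Summable fun n => |coeff n g|) :
    Tendsto (fun n => coeff n (f * g)) atTop (𝓝 0) := by
  obtain ⟨B, hB⟩ := hf.abs.bddAbove_range
  have hB' : ∀ n, |coeff n f| ≤ B := fun n => hB ⟨n, rfl⟩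
  have hB0 : 0 ≤ B := (abs_nonneg _).trans (hB' 0)
  have h := tendsto_tsum_of_dominated_convergence (𝓕 := atTop)
    (f := fun (n j : ℕ) => if j ≤ n then coeff j g * coeff (n - j) f else 0)
    (g := fun _ => (0 : ℝ)) (bound := fun j => |coeff j g| * B) (hg.mul_right B)
    (fun j => by
      have h1 : Tendsto (fun n => coeff j g * coeff (n - j) f) atTop (𝓝 (coeff j g * 0)) :=
        (hf.comp (tendsto_sub_atTop_nat j)).const_mul _
      rw [mul_zero] at h1
      refine h1.congr' ?_
      filter_upwards [eventually_ge_atTop j] with n hn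
      rw [if_pos hn])
    (Eventually.of_forall fun n j => by
      split_ifs
      · rw [Real.norm_eq_abs, abs_mul]
        exact mul_le_mul_of_nonneg_left (hB' _) (abs_nonneg _)
      · rw [norm_zero]
        positivity)
  rw [tsum_zero] at h
  refine h.congr fun n => ?_
  rw [mul_comm f g, coeff_mul, Finset.Nat.sum_antidiagonal_eq_sum_range_succ_mk,
    tsum_eq_sum (s := Finset.range n.succ)]
  · refine Finset.sum_congr rfl fun j hj => if_pos ?_
    simpa [Nat.lt_succ_iff] using hj
  · intro j hj
    refine if_neg ?_
    simpa [Nat.lt_succ_iff] using hj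

lemma tendsto_h0 {r : ℝ} (hr : r ∈ Set.Ioc (-1 : ℝ) 1) :
    Tendsto (fun n : ℕ => h0 r n) atTop (𝓝 0) := by
  simp_rw [h0_natCast]
  rcases hr.2.eq_or_lt with rfl | hr1
  · exact tendsto_coeff_h0Series_one
  · refine tendsto_coeff_mul_of_summable tendsto_coeff_invSqrtSeries ?_
    have habs : |r| < 1 := abs_lt.2 ⟨hr.1, hr1⟩
    obtain ⟨B, hB⟩ := tendsto_coeff_invSqrtSeries.abs.bddAbove_range
    refine Summable.of_nonneg_of_le (fun n => abs_nonneg _) (fun n => ?_)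
      ((summable_geometric_of_lt_one (abs_nonneg r) habs).mul_right B)
    rw [coeff_rescale, abs_mul, abs_pow, abs_neg]
    exact mul_le_mul_of_nonneg_left (hB ⟨n, rfl⟩) (by positivity)

lemma coeff_h0Series_sq {r : ℝ} (n : ℕ) :
    (1 + r) * coeff n (h0Series r ^ 2) = 1 - (-r) ^ (n + 1) := by
  have h := h0Series_sq_mul r
  have h2 : (C (1 + r) * h0Series r ^ 2) * ((1 - X) * (1 + C r * X))
      = (PowerSeries.mk fun n => 1 - (-r) ^ (n + 1)) * ((1 - X) * (1 + C r * X)) := by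
    rw [mul_assoc, h, mul_one, ← mul_assoc]
    have e : (PowerSeries.mk fun n => 1 - (-r) ^ (n + 1)) * (1 - X)
        = C (1 + r) * PowerSeries.mk fun n => (-r) ^ n := by
      ext n
      rw [coeff_C_mul, mul_sub, mul_one, map_sub]
      cases n with
      | zero => simp
      | succ n => simp only [coeff_succ_mul_X, coeff_mk]; ring
    have e2 : (PowerSeries.mk fun n => (-r) ^ n) * (1 + C r * X) = 1 := by
      ext n
      rw [mul_add, mul_one, map_add, mul_left_comm, coeff_C_mul]
      cases n with
      | zero => simp
      | succ n => simp only [coeff_succ_mul_X, coeff_mk, coeff_one]; rw [if_neg (by omega)]; ring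
    rw [e, mul_assoc, e2, mul_one]
  have hne : (1 - X) * (1 + C r * X) ≠ (0 : PowerSeries ℝ) := right_ne_zero_of_mul_eq_one h
  have := congrArg (coeff n) (mul_right_cancel₀ hne h2)
  rwa [coeff_C_mul, coeff_mk] at this

lemma not_bounded_sum_h0 {r : ℝ} (hr : r ∈ Set.Ioc (-1 : ℝ) 1) (hnn : ∀ l, 0 ≤ h0 r l) (B : ℝ)
    (hB : ∀ N : ℕ, ∑ n ∈ Finset.range N, h0 r (n : ℤ) ≤ B) : False := by
  have hr0 : 0 < 1 + r := by linarith [hr.1]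
  have hs : Summable fun n : ℕ => h0 r n := summable_of_sum_range_le (fun n => hnn (n : ℤ)) hB
  have hsq : Summable fun n : ℕ =>
      ‖∑ kl ∈ Finset.HasAntidiagonal.antidiagonal n, h0 r kl.1 * h0 r kl.2‖ :=
    summable_norm_sum_mul_antidiagonal_of_summable_norm (f := fun n : ℕ => h0 r n)
      (g := fun n : ℕ => h0 r n) hs.norm hs.norm
  have ht : Tendsto (fun n => coeff n (h0Series r ^ 2)) atTop (𝓝 0) := by
    refine (tendsto_zero_iff_norm_tendsto_zero.2 hsq.tendsto_atTop_zero).congr fun n => ?_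
    simp_rw [sq, coeff_mul, h0_natCast]
  have ht2 : Tendsto (fun n : ℕ => coeff (2 * n) (h0Series r ^ 2)) atTop (𝓝 0) :=
    ht.comp (tendsto_atTop_mono (fun n => show n ≤ 2 * n by omega) tendsto_id)
  have : (1 / 2 : ℝ) ≤ 0 := by
    refine ge_of_tendsto' ht2 fun n => ?_
    have h := coeff_h0Series_sq (r := r) (2 * n)
    have hodd : Odd (2 * n + 1) := ⟨n, rfl⟩
    rw [← mul_le_mul_iff_right₀ hr0, h, hodd.neg_pow]
    rcases le_total 0 r with h0 | h0
    · have := pow_nonneg h0 (2 * n + 1)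
      linarith [hr.2]
    · have h3 : |r| ^ (2 * n + 1) ≤ |r| :=
        pow_le_of_le_one (abs_nonneg r) (abs_le.2 ⟨hr.1.le, hr.2⟩) (by omega)
      rw [abs_of_nonpos h0, hodd.neg_pow] at h3
      linarith
  linarith

/-- Maximum principle for functions harmonic on the positive integers. -/
lemma nonpos_of_harmonic {ν : ℤ → ℝ} (hprob : IsProbDist ν) (hν2 : 0 < ν (-2)) {w : ℤ → ℝ}
    (hw : ∀ k : ℤ, 1 ≤ k → HasSum (fun l => w (k + l) * ν l) (w k))
    (hw0 : ∀ k : ℤ, k ≤ 0 → w k ≤ 0)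
    (hlim : ∀ ε > 0, ∃ N : ℤ, ∀ k, N ≤ k → w k < ε) (k : ℤ) : w k ≤ 0 := by
  by_contra! hk
  obtain ⟨N, hN⟩ := hlim _ hk
  have hk1 : 1 ≤ k := by
    by_contra! h
    linarith [hw0 k (by omega)]
  obtain ⟨k₀, -, hmax⟩ := Finset.exists_max_image (Finset.Icc 1 (max N k)) w
    ⟨k, by simp [hk1]⟩
  have hkk : w k ≤ w k₀ := hmax k (by simp [hk1])
  have hall : ∀ j, w j ≤ w k₀ := by
    intro j
    rcases le_or_gt j 0 with h | h
    · linarith [hw0 j h]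
    · rcases le_or_gt j (max N k) with h2 | h2
      · exact hmax j (by simp only [Finset.mem_Icc]; omega)
      · linarith [hN j (by omega)]
  have hstep : ∀ j, w j = w k₀ → w (j - 2) = w k₀ := by
    intro j hj
    have hj1 : 1 ≤ j := by
      by_contra! h
      linarith [hw0 j (by omega)]
    have h := (hprob.2.mul_left (w k₀)).sub (hw j hj1)
    rw [mul_one, hj, sub_self] at h
    have h2 := (hasSum_zero_iff_of_nonneg (fun l => by
      simp only [← sub_mul]
      exact mul_nonneg (sub_nonneg.2 (hall _)) (hprob.1 l))).1 h
    have h3 := congrFun h2 (-2)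
    simp only [Pi.zero_apply, ← sub_mul] at h3
    have h4 := (mul_eq_zero.1 h3).resolve_right hν2.ne'
    rw [sub_eq_add_neg]
    linarith
  have hiter : ∀ n : ℕ, w (k₀ - 2 * n) = w k₀ := by
    intro n
    induction n with
    | zero => simp
    | succ n ih =>
      rw [← hstep _ ih]
      congr 1
      push_cast
      ring
  have := hiter k₀.toNat
  linarith [hw0 (k₀ - 2 * k₀.toNat) (by omega)]

/-- If `h0 r` is harmonic, then a bounded monotone harmonic function vanishing on `k ≤ 0` also
vanishes at `1`. -/
lemma eq_zero_of_harmonic_of_monotone {r : ℝ} (hr : r ∈ Set.Ioc (-1 : ℝ) 1) {ν : ℤ → ℝ}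
    (hprob : IsProbDist ν) (hν2 : 0 < ν (-2)) (hharm : NuHarmonic ν (h0 r)) {s : ℤ → ℝ}
    (hs0 : ∀ k ≤ 0, s k = 0) (hs1 : ∀ k, s k ≤ 1) (hmono : Monotone s)
    (hs : ∀ k : ℤ, 1 ≤ k → HasSum (fun l => s (k + l) * ν l) (s k)) : s 1 = 0 := by
  by_contra hne
  have hpos : 0 < s 1 := lt_of_le_of_ne (by rw [← hs0 0 le_rfl]; exact hmono zero_le_one)
    (Ne.symm hne)
  have hle : ∀ k, s 1 * h0 r k - (s (k + 1) - s k) ≤ 0 := by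
    apply nonpos_of_harmonic hprob hν2
    · intro k hk
      refine (((hharm.2 k hk).mul_left (s 1)).sub
        ((hs (k + 1) (by omega)).sub (hs k hk))).congr_fun fun l => ?_
      rw [show k + 1 + l = k + l + 1 by ring]
      ring
    · intro k hk
      rcases hk.eq_or_lt with rfl | hk
      · simp [h0_zero, hs0]
      · simp [h0_of_neg r hk, hs0 k hk.le, hs0 (k + 1) (by omega)]
    · intro ε hε
      have := ((tendsto_h0 hr).const_mul (s 1)).eventually_lt_const (by simpa using hε)
      obtain ⟨N, hN⟩ := eventually_atTop.1 this
      refine ⟨N, fun k hk => ?_⟩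
      lift k to ℕ using by omega
      have h1 := hN k (by omega)
      have h2 := hmono (show (k : ℤ) ≤ k + 1 by omega)
      linarith
  refine not_bounded_sum_h0 hr hharm.1 (1 / s 1) fun N => ?_
  rw [le_div_iff₀ hpos, Finset.sum_mul]
  calc ∑ n ∈ Finset.range N, h0 r n * s 1
      ≤ ∑ n ∈ Finset.range N, (s ((n + 1 : ℕ) : ℤ) - s (n : ℕ)) :=
        Finset.sum_le_sum fun n _ => by
          have := hle n
          push_cast
          linarith
    _ = s N - s 0 := by rw [Finset.sum_range_sub (fun n : ℕ => s n)]; simp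
    _ ≤ 1 := by rw [hs0 0 le_rfl, sub_zero]; exact hs1 _

end Analytic

section Walk

variable {Ω : Type*} [MeasurableSpace Ω] {μ : Measure Ω} {ν : ℤ → ℝ}
  {Y : ℕ → Ω → ℤ}

/-- The step sequences for which the walk started at `k` stays positive forever. -/
def survivalSet (k : ℤ) : Set (ℕ → ℤ) :=
  {y | ∀ i : ℕ, 1 ≤ k + ∑ m ∈ Finset.range i, y m}

lemma measurableSet_survivalSet (k : ℤ) : MeasurableSet (survivalSet k) := by
  rw [survivalSet, Set.ofPred_forall]
  refine MeasurableSet.iInter fun i => measurableSet_le measurable_const ?_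
  fun_prop

lemma mem_survivalSet_iff {k : ℤ} (hk : 1 ≤ k) (y : ℕ → ℤ) :
    y ∈ survivalSet k ↔ (fun j => y (j + 1)) ∈ survivalSet (k + y 0) := by
  constructor
  · intro h i
    have := h (i + 1)
    rw [Finset.sum_range_succ'] at this
    linarith
  · intro h i
    cases i with
    | zero => simpa using hk
    | succ i =>
      have := h i
      rw [Finset.sum_range_succ']
      linarith

lemma identDistrib_shift (hmeas : ∀ j, Measurable (Y j)) (hindep : iIndepFun Y μ)
    (hlaw : ∀ j k, μ (Y j ⁻¹' {k}) = ENNReal.ofReal (ν k)) :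
    IdentDistrib (fun ω j => Y (j + 1) ω) (fun ω j => Y j ω) μ μ := by
  refine IdentDistrib.pi (fun j => ⟨(hmeas _).aemeasurable, (hmeas _).aemeasurable, ?_⟩)
    (hindep.precomp (add_left_injective 1)) hindep
  refine Measure.ext_of_singleton fun k => ?_
  rw [Measure.map_apply (hmeas _) (measurableSet_singleton k),
    Measure.map_apply (hmeas _) (measurableSet_singleton k), hlaw, hlaw]

lemma indepFun_zero_shift (hmeas : ∀ j, Measurable (Y j)) (hindep : iIndepFun Y μ) :
    IndepFun (Y 0) (fun ω j => Y (j + 1) ω) μ := by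
  have h := indep_iSup_of_disjoint (fun j => (hmeas j).comap_le) hindep
    (S := {0}) (T := {j | 0 < j}) (by simp)
  refine indep_of_indep_of_le_left (indep_of_indep_of_le_right h ?_) ?_
  · refine Measurable.comap_le (@measurable_pi_lambda _ _ _ (_) _ _ fun j => ?_)
    exact Measurable.of_comap_le (le_iSup₂_of_le (j + 1) (Nat.succ_pos j) le_rfl)
  · exact le_iSup₂_of_le 0 rfl le_rfl

lemma measure_survival_eq_tsum (hmeas : ∀ j, Measurable (Y j)) (hindep : iIndepFun Y μ)
    (hlaw : ∀ j k, μ (Y j ⁻¹' {k}) = ENNReal.ofReal (ν k)) {k : ℤ} (hk : 1 ≤ k) :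
    μ ((fun ω j => Y j ω) ⁻¹' survivalSet k) =
      ∑' l, μ ((fun ω j => Y j ω) ⁻¹' survivalSet (k + l)) * ENNReal.ofReal (ν l) := by
  have hshift : Measurable fun ω j => Y (j + 1) ω := measurable_pi_iff.2 fun j => hmeas _
  have e : (fun ω j => Y j ω) ⁻¹' survivalSet k =
      ⋃ l, Y 0 ⁻¹' {l} ∩ (fun ω j => Y (j + 1) ω) ⁻¹' survivalSet (k + l) := by
    ext ω
    simp [mem_survivalSet_iff hk]
  rw [e, measure_iUnion]
  · refine tsum_congr fun l => ?_
    rw [(indepFun_zero_shift hmeas hindep).measure_inter_preimage_eq_mul _ _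
      (measurableSet_singleton l) (measurableSet_survivalSet _), hlaw, mul_comm,
      (identDistrib_shift hmeas hindep hlaw).measure_preimage_eq (measurableSet_survivalSet _)]
  · intro l l' hll
    refine Disjoint.mono Set.inter_subset_left Set.inter_subset_left ?_
    exact Disjoint.preimage _ (by simpa using hll)
  · exact fun l => ((hmeas 0) (measurableSet_singleton l)).inter
      (hshift (measurableSet_survivalSet _))

lemma hasSum_measureReal_survival [IsFiniteMeasure μ] (hprob : IsProbDist ν)
    (hmeas : ∀ j, Measurable (Y j)) (hindep : iIndepFun Y μ)
    (hlaw : ∀ j k, μ (Y j ⁻¹' {k}) = ENNReal.ofReal (ν k)) {k : ℤ} (hk : 1 ≤ k) :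
    HasSum (fun l => μ.real ((fun ω j => Y j ω) ⁻¹' survivalSet (k + l)) * ν l)
      (μ.real ((fun ω j => Y j ω) ⁻¹' survivalSet k)) := by
  have h := measure_survival_eq_tsum hmeas hindep hlaw hk
  have h2 := ENNReal.hasSum_toReal (h ▸ measure_ne_top μ _)
  rw [← ENNReal.tsum_toReal_eq (fun l => by finiteness), ← h] at h2
  simpa [Measure.real, ENNReal.toReal_ofReal (hprob.1 _)] using h2

lemma monotone_survivalSet : Monotone survivalSet := by
  intro k k' hkk y hy i
  have := hy i
  omega

lemma survivalSet_of_nonpos {k : ℤ} (hk : k ≤ 0) : survivalSet k = ∅ := by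
  refine Set.eq_empty_of_forall_notMem fun y hy => ?_
  have := hy 0
  simp only [Finset.range_zero, Finset.sum_empty] at this
  omega

end Walk

/-- the random walk does not drift to `+∞`:
`P(X_i ≥ X_0 for all i) = 0`. -/
theorem stmt5 {Ω : Type*} [MeasurableSpace Ω] (μ : Measure Ω) [IsProbabilityMeasure μ]
    (r : ℝ) (hr : r ∈ Set.Ioc (-1 : ℝ) 1)
    (ν : ℤ → ℝ) (hprob : IsProbDist ν) (hν2 : 0 < ν (-2))
    (hharm : NuHarmonic ν (h0 r))
    (Y : ℕ → Ω → ℤ) (hmeas : ∀ j, Measurable (Y j))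
    (hindep : iIndepFun Y μ)
    (hlaw : ∀ j k, μ (Y j ⁻¹' {k}) = ENNReal.ofReal (ν k)) :
    μ {ω | ∀ i : ℕ, 0 ≤ ∑ m ∈ Finset.range i, Y m ω} = 0 := by
  have h := eq_zero_of_harmonic_of_monotone hr hprob hν2 hharm
    (s := fun k => μ.real ((fun ω j => Y j ω) ⁻¹' survivalSet k))
    (fun k hk => by simp [survivalSet_of_nonpos hk]) (fun k => measureReal_le_one)
    (fun k k' hkk => measureReal_mono (Set.preimage_mono (monotone_survivalSet hkk)))
    (fun k hk => hasSum_measureReal_survival hprob hmeas hindep hlaw hk)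
  rw [measureReal_eq_zero_iff] at h
  convert h using 2
  ext ω
  simp [survivalSet]
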